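/- For all i, j with 1 ≤ i, j ≤ a1−1: the k-vector space Hom(M(s_i), M(s_j)) is zero if i < j, and has dimension 1 if i ≥ j. -/

import Mathlib

inductive V (a1 a2 : ℕ) : Type where
  | r : Fin (a2 + 1) → V a1 a2
  | s : Fin (a1 - 1) → V a1 a2
  | t : Fin (a1 - 1) → V a1 a2

def Arrow (a1 a2 : ℕ) : V a1 a2 → V a1 a2 → Prop
  | .r i, .r j => ((i : ℕ) + 1 = (j : ℕ)) ∨ ((i : ℕ) = a2 ∧ (j : ℕ) = 0)
  | .s i, .s j => (i : ℕ) + 1 = (j : ℕ)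
  | .s i, .r j => (i : ℕ) = a1 - 2 ∧ (j : ℕ) = a2
  | .r i, .t j => (i : ℕ) = 0 ∧ (j : ℕ) = 0
  | .t i, .t j => (i : ℕ) + 1 = (j : ℕ)
  | _, _ => False

structure Repn (k : Type) [Field k] (a1 a2 : ℕ) : Type 1 where
  carrier : V a1 a2 → Type
  [acg : ∀ x, AddCommGroup (carrier x)]
  [mod : ∀ x, Module k (carrier x)]
  fd : ∀ x, FiniteDimensional k (carrier x)
  map : ∀ (x y : V a1 a2), Arrow a1 a2 x y → (carrier x →ₗ[k] carrier y)

attribute [instance] Repn.acg Repn.mod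

def HomSpace {k : Type} [Field k] {a1 a2 : ℕ} (ρ σ : Repn k a1 a2) :
    Submodule k (∀ x : V a1 a2, ρ.carrier x →ₗ[k] σ.carrier x) where
  carrier := {f | ∀ (x y : V a1 a2) (h : Arrow a1 a2 x y),
      (σ.map x y h).comp (f x) = (f y).comp (ρ.map x y h)}
  add_mem' := by
    intro f g hf hg
    intro x y h
    simp only [Pi.add_apply, LinearMap.comp_add, LinearMap.add_comp]
    rw [hf x y h, hg x y h]
  zero_mem' := by
    intro x y h
    simp
  smul_mem' := by
    intro c f hf
    intro x y h
    simp only [Pi.smul_apply, LinearMap.comp_smul, LinearMap.smul_comp]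
    rw [hf x y h]

def IsSubrep {k : Type} [Field k] {a1 a2 : ℕ} (ρ : Repn k a1 a2)
    (N : ∀ x, Submodule k (ρ.carrier x)) : Prop :=
  ∀ (x y : V a1 a2) (h : Arrow a1 a2 x y), ∀ v ∈ N x, ρ.map x y h v ∈ N y

open Classical in
noncomputable def sp (k : Type) [Field k] {a1 a2 : ℕ} (S : Set (V a1 a2)) (x : V a1 a2) :
    Submodule k k :=
  if x ∈ S then ⊤ else ⊥

open Classical in
noncomputable def thinMap (k : Type) [Field k] {a1 a2 : ℕ} (S T : Set (V a1 a2))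
    (x y : V a1 a2) : (sp k S x) →ₗ[k] (sp k T y) where
  toFun v := if h : y ∈ T then ⟨(v : k), by simp [sp, h]⟩ else 0
  map_add' u v := by
    by_cases h : y ∈ T
    · simp only [dif_pos h]
      exact Subtype.ext (by simp)
    · simp [dif_neg h]
  map_smul' c v := by
    by_cases h : y ∈ T
    · simp only [dif_pos h]
      exact Subtype.ext (by simp)
    · simp [dif_neg h]

noncomputable def thinRep (k : Type) [Field k] {a1 a2 : ℕ} (S : Set (V a1 a2)) :
    Repn k a1 a2 where
  carrier x := ↥(sp k S x)
  acg := fun _ => inferInstance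
  mod := fun _ => inferInstance
  fd := fun _ => inferInstance
  map x y _ := thinMap k S S x y

def suppR (a1 a2 : ℕ) (i : ℕ) : Set (V a1 a2) :=
  {x | match x with
      | .r j => (j : ℕ) ≠ i
      | .s _ => i ≠ a2
      | .t _ => i ≠ 0}

def suppS (a1 a2 : ℕ) (i : ℕ) : Set (V a1 a2) :=
  {x | match x with
      | .r j => (j : ℕ) < a2
      | .s _ => False
      | .t j => (j : ℕ) + 1 < i}

def suppT (a1 a2 : ℕ) (i : ℕ) : Set (V a1 a2) :=
  {x | match x with
      | .r j => 1 ≤ (j : ℕ)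
      | .s j => i ≤ (j : ℕ)
      | .t _ => False}

noncomputable def Mr (k : Type) [Field k] (a1 a2 : ℕ) (i : ℕ) : Repn k a1 a2 :=
  thinRep k (suppR a1 a2 i)

noncomputable def Ms (k : Type) [Field k] (a1 a2 : ℕ) (i : ℕ) : Repn k a1 a2 :=
  thinRep k (suppS a1 a2 i)

noncomputable def Mt (k : Type) [Field k] (a1 a2 : ℕ) (i : ℕ) : Repn k a1 a2 :=
  thinRep k (suppT a1 a2 i)

noncomputable def Mv (k : Type) [Field k] (a1 a2 : ℕ) : V a1 a2 → Repn k a1 a2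
  | .r j => Mr k a1 a2 (j : ℕ)
  | .s j => Ms k a1 a2 ((j : ℕ) + 1)
  | .t j => Mt k a1 a2 ((j : ℕ) + 1)

open Classical in
noncomputable def eone (k : Type) [Field k] {a1 a2 : ℕ} (S : Set (V a1 a2)) (x : V a1 a2) :
    sp k S x := if h : x ∈ S then ⟨1, by simp [sp, h]⟩ else 0

noncomputable def coef {k : Type} [Field k] {a1 a2 : ℕ} {S T : Set (V a1 a2)}
    (f : ∀ x : V a1 a2, sp k S x →ₗ[k] sp k T x) (x : V a1 a2) : k := (f x (eone k S x) : k)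

lemma sp_zero {k : Type} [Field k] {a1 a2 : ℕ} {S : Set (V a1 a2)} {x : V a1 a2}
    (h : x ∉ S) (v : sp k S x) : v = 0 := by
  have := v.2
  simp only [sp, h, if_false, Submodule.mem_bot] at this
  exact Subtype.ext this

lemma eone_smul {k : Type} [Field k] {a1 a2 : ℕ} {S : Set (V a1 a2)} {x : V a1 a2}
    (v : sp k S x) : v = (v : k) • eone k S x := by
  by_cases h : x ∈ S
  · apply Subtype.ext
    simp [eone, h]
  · rw [sp_zero h v]; simp

lemma thin_eone {k : Type} [Field k] {a1 a2 : ℕ} {S T : Set (V a1 a2)} {x y : V a1 a2}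
    (h : x ∈ S) : thinMap k S T x y (eone k S x) = eone k T y := by
  by_cases hy : y ∈ T <;> simp [thinMap, eone, h, hy]

lemma thin_coe {k : Type} [Field k] {a1 a2 : ℕ} {S T : Set (V a1 a2)} {x y : V a1 a2}
    (h : y ∈ T) (v : sp k S x) : (thinMap k S T x y v : k) = v := by
  simp [thinMap, h]

lemma coef_arrow {k : Type} [Field k] {a1 a2 : ℕ} {S T : Set (V a1 a2)}
    {f : ∀ x : V a1 a2, sp k S x →ₗ[k] sp k T x}
    (hf : f ∈ HomSpace (thinRep k S) (thinRep k T)) {x y : V a1 a2} (h : Arrow a1 a2 x y)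
    (hx : x ∈ S) (hy : y ∈ T) : coef f y = coef f x := by
  have h1 : (thinMap k T T x y).comp (f x) = (f y).comp (thinMap k S S x y) := hf x y h
  have h2 := LinearMap.congr_fun h1 (eone k S x)
  simp only [LinearMap.comp_apply, thin_eone hx] at h2
  rw [coef, ← h2, thin_coe hy]; rfl

lemma ext_coef {k : Type} [Field k] {a1 a2 : ℕ} {S T : Set (V a1 a2)}
    {f g : ∀ x : V a1 a2, sp k S x →ₗ[k] sp k T x}
    (h : ∀ x ∈ S, x ∈ T → coef f x = coef g x) : f = g := by
  funext x
  ext v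
  by_cases hx : x ∈ S
  · by_cases hT : x ∈ T
    · have := h x hx hT
      unfold coef at this
      rw [eone_smul v, map_smul, map_smul, Submodule.coe_smul, Submodule.coe_smul, this]
    · rw [sp_zero hT (f x v), sp_zero hT (g x v)]
  · rw [sp_zero hx v]; simp

lemma coef_zero {k : Type} [Field k] {a1 a2 : ℕ} {S T : Set (V a1 a2)}
    {f : ∀ x : V a1 a2, sp k S x →ₗ[k] sp k T x} {x : V a1 a2} (h : x ∉ S) :
    coef f x = 0 := by
  unfold coef
  rw [sp_zero h (eone k S x), map_zero]; rfl

lemma coef_r {k : Type} [Field k] {a1 a2 i j : ℕ}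
    {f : ∀ x : V a1 a2, sp k (suppS a1 a2 i) x →ₗ[k] sp k (suppS a1 a2 j) x}
    (hf : f ∈ HomSpace (Ms k a1 a2 i) (Ms k a1 a2 j)) (n : ℕ) (hn : n < a2) :
    coef f (.r ⟨n, by omega⟩) = coef f (.r 0) := by
  induction n with
  | zero => rfl
  | succ n ih =>
    rw [← ih (by omega)]
    refine coef_arrow hf ?_ ?_ ?_
    · simp [Arrow]
    · simp [suppS]; omega
    · simp [suppS]; omega

lemma coef_t {k : Type} [Field k] {a1 a2 i j : ℕ} (ha2 : 0 < a2)
    {f : ∀ x : V a1 a2, sp k (suppS a1 a2 i) x →ₗ[k] sp k (suppS a1 a2 j) x}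
    (hf : f ∈ HomSpace (Ms k a1 a2 i) (Ms k a1 a2 j)) (n : ℕ) (hn : n < a1 - 1)
    (hi : n < i) (hj : n + 1 < j) :
    coef f (.t ⟨n, hn⟩) = coef f (.r 0) := by
  induction n with
  | zero =>
    refine coef_arrow hf ?_ ?_ ?_
    · simp [Arrow]
    · simp [suppS]; omega
    · simp [suppS]; omega
  | succ n ih =>
    rw [← ih (by omega) (by omega) (by omega)]
    refine coef_arrow hf ?_ ?_ ?_
    · simp [Arrow]
    · simp [suppS]; omega
    · simp [suppS]; omega

lemma coef_all {k : Type} [Field k] {a1 a2 i j : ℕ} (ha2 : 0 < a2)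
    {f : ∀ x : V a1 a2, sp k (suppS a1 a2 i) x →ₗ[k] sp k (suppS a1 a2 j) x}
    (hf : f ∈ HomSpace (Ms k a1 a2 i) (Ms k a1 a2 j)) (x : V a1 a2)
    (hi : x ∈ suppS a1 a2 i) (hj : x ∈ suppS a1 a2 j) :
    coef f x = coef f (.r 0) := by
  match x, hi, hj with
  | .r ⟨n, hn⟩, hi, hj => exact coef_r hf n hi
  | .s _, hi, hj => exact hi.elim
  | .t ⟨n, hn⟩, hi, hj =>
    have hi' : n + 1 < i := hi
    exact coef_t ha2 hf n hn (by omega) hj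

lemma thin_mem {k : Type} [Field k] {a1 a2 i j : ℕ} (hij : j ≤ i) :
    (fun x => thinMap k (suppS a1 a2 i) (suppS a1 a2 j) x x) ∈
      HomSpace (Ms k a1 a2 i) (Ms k a1 a2 j) := by
  intro x y h
  change (thinMap k (suppS a1 a2 j) (suppS a1 a2 j) x y).comp
      (thinMap k (suppS a1 a2 i) (suppS a1 a2 j) x x) =
    (thinMap k (suppS a1 a2 i) (suppS a1 a2 j) y y).comp
      (thinMap k (suppS a1 a2 i) (suppS a1 a2 i) x y)
  apply LinearMap.ext
  intro v
  by_cases hx : x ∈ suppS a1 a2 i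
  swap
  · rw [sp_zero hx v]; simp
  by_cases hy : y ∈ suppS a1 a2 j
  swap
  · exact (sp_zero hy _).trans (sp_zero hy _).symm
  have hyi : y ∈ suppS a1 a2 i := by
    cases y <;> simp [suppS] at hy ⊢ <;> omega
  have hxj : x ∈ suppS a1 a2 j := by
    cases x <;> cases y <;> simp [suppS, Arrow] at hx hy h ⊢ <;> omega
  apply Subtype.ext
  simp only [LinearMap.comp_apply]
  rw [thin_coe hy, thin_coe hxj, thin_coe hy, thin_coe hyi]

/-- For `1 ≤ i, j ≤ a1 - 1`, `Hom(M(s_i), M(s_j))` is zero if `i < j` and is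
one-dimensional if `i ≥ j`. -/
theorem statement12 (k : Type) [Field k] (a1 a2 : ℕ) (ha1 : 0 < a1) (ha2 : 0 < a2)
    (i j : ℕ) (hi1 : 1 ≤ i) (hi2 : i ≤ a1 - 1) (hj1 : 1 ≤ j) (hj2 : j ≤ a1 - 1) :
    (i < j → HomSpace (Ms k a1 a2 i) (Ms k a1 a2 j) = ⊥) ∧
    (j ≤ i → Module.finrank k ↥(HomSpace (Ms k a1 a2 i) (Ms k a1 a2 j)) = 1) := by
  have hr : ∀ n, (V.r 0 : V a1 a2) ∈ suppS a1 a2 n := fun n => by simp [suppS]; omega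
  constructor
  · intro hij
    rw [eq_bot_iff]
    intro f hf
    have h0 : coef (S := suppS a1 a2 i) (T := suppS a1 a2 j) f (.r 0) = 0 := by
      rw [← coef_t ha2 hf (i - 1) (by omega) (by omega) (by omega)]
      have hn : (V.t ⟨i - 1, by omega⟩ : V a1 a2) ∉ suppS a1 a2 i := by
        simp [suppS]; omega
      exact coef_zero hn
    rw [Submodule.mem_bot]
    refine ext_coef (S := suppS a1 a2 i) (T := suppS a1 a2 j) (g := 0) fun x hx hx' => ?_
    rw [coef_all ha2 hf x hx hx', h0]
    rfl
  · intro hij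
    have hc : ∀ x ∈ suppS a1 a2 j,
        coef (fun x => thinMap k (suppS a1 a2 i) (suppS a1 a2 j) x x) x =
          (eone k (suppS a1 a2 i) x : k) := fun x hx => thin_coe hx _
    have he : ∀ x ∈ suppS a1 a2 i, (eone k (suppS a1 a2 i) x : k) = 1 := fun x hx => by
      simp [eone, hx]
    refine finrank_eq_one_iff'.2 ⟨⟨_, thin_mem hij⟩, ?_, ?_⟩
    · intro h
      have h1 := congrArg Subtype.val h
      have h2 : coef (fun x => thinMap k (suppS a1 a2 i) (suppS a1 a2 j) x x) (.r 0) =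
          coef (k := k) (S := suppS a1 a2 i) (T := suppS a1 a2 j) 0 (.r 0) :=
        congrArg (fun f => coef (S := suppS a1 a2 i) (T := suppS a1 a2 j) f (.r 0)) h1
      rw [hc _ (hr _), he _ (hr _)] at h2
      exact one_ne_zero h2
    · rintro ⟨f, hf⟩
      refine ⟨coef (S := suppS a1 a2 i) (T := suppS a1 a2 j) f (.r 0), ?_⟩
      apply Subtype.ext
      refine ext_coef (S := suppS a1 a2 i) (T := suppS a1 a2 j) fun x hx hx' => ?_
      rw [coef_all ha2 hf x hx hx']
      change coef (S := suppS a1 a2 i) (T := suppS a1 a2 j) f (.r 0) *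
        coef (fun x => thinMap k (suppS a1 a2 i) (suppS a1 a2 j) x x) x = _
      rw [hc x hx', he x hx, mul_one]
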